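/- arXiv:1705.09443 — 3 statements merged into one kernel-verified Lean document; each statement's English description precedes it below -/
import Mathlib

section
/- Let ω be a real number, let σ : ℝ → ℝ be differentiable, and let (r₁, r₂) ∈ ℝ² with r₁² + r₂² = 1. Define the complex-stretched coordinates x_d^σ = x_d + i σ(x_d) and the modified plane wave F^σ(x₁, x₂) = exp(i ω (r₁ x₁^σ + r₂ x₂^σ)). For a function g of (x₁, x₂), let D_d g denote the stretched derivative (D_d g)(x) = (1/(1 + i σ′(x_d))) · ∂g/∂x_d (x). Then at every point x = (x₁, x₂) with 1 + i σ′(x₁) ≠ 0 and 1 + i σ′(x₂) ≠ 0, the function F^σ satisfies the PML-modified Helmholtz equation −(D₁(D₁ F^σ))(x) − (D₂(D₂ F^σ))(x) − ω² F^σ(x) = 0. -/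
open Complex

/-- The PML-stretched derivative along the first coordinate:
`(D₁ g)(x₁, x₂) = (1/(1 + i σ′(x₁))) ∂₁ g (x₁, x₂)`. -/
noncomputable def pmlD1 (σ : ℝ → ℝ) (g : ℝ → ℝ → ℂ) : ℝ → ℝ → ℂ :=
  fun x₁ x₂ => (1 + Complex.I * ((deriv σ x₁ : ℝ) : ℂ))⁻¹ * deriv (fun t => g t x₂) x₁

/-- The PML-stretched derivative along the second coordinate:
`(D₂ g)(x₁, x₂) = (1/(1 + i σ′(x₂))) ∂₂ g (x₁, x₂)`. -/
noncomputable def pmlD2 (σ : ℝ → ℝ) (g : ℝ → ℝ → ℂ) : ℝ → ℝ → ℂ :=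
  fun x₁ x₂ => (1 + Complex.I * ((deriv σ x₂ : ℝ) : ℂ))⁻¹ * deriv (fun t => g x₁ t) x₂

/-- The factor `1 + i s` of a real stretching rate `s` never vanishes. -/
lemma one_add_I_mul_ofReal_ne_zero (s : ℝ) : (1 : ℂ) + Complex.I * (s : ℂ) ≠ 0 := fun h => by
  simpa using congrArg Complex.re h

/-- The derivative of an exponential of the stretched coordinate `t + i σ(t)`. -/
lemma hasDerivAt_exp_stretched {σ : ℝ → ℝ} {t : ℝ} (hσ : DifferentiableAt ℝ σ t) (c b : ℂ) :
    HasDerivAt (fun s : ℝ => Complex.exp (c * ((s : ℂ) + Complex.I * (σ s : ℂ)) + b))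
      ((1 + Complex.I * ((deriv σ t : ℝ) : ℂ)) *
        (c * Complex.exp (c * ((t : ℂ) + Complex.I * (σ t : ℂ)) + b))) t := by
  have hid : HasDerivAt (fun s : ℝ => (s : ℂ)) 1 t := (hasDerivAt_id t).ofReal_comp
  have hstretch : HasDerivAt (fun s : ℝ => (s : ℂ) + Complex.I * (σ s : ℂ))
      (1 + Complex.I * ((deriv σ t : ℝ) : ℂ)) t :=
    hid.add (hσ.hasDerivAt.ofReal_comp.const_mul Complex.I)
  convert ((hstretch.const_mul c).add_const b).cexp using 1
  ring

/-- A function that is an exponential of the stretched first coordinate on each line is an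
eigenfunction of `pmlD1`. -/
lemma pmlD1_eq_const_mul {σ : ℝ → ℝ} (hσ : Differentiable ℝ σ) {g : ℝ → ℝ → ℂ} {a c : ℂ}
    {b : ℝ → ℂ}
    (hg : ∀ x y : ℝ, g x y = a * Complex.exp (c * ((x : ℂ) + Complex.I * (σ x : ℂ)) + b y)) :
    pmlD1 σ g = fun x y => c * g x y := by
  funext x y
  simp only [pmlD1, hg]
  rw [((hasDerivAt_exp_stretched (hσ x) c (b y)).const_mul a).deriv]
  field_simp [one_add_I_mul_ofReal_ne_zero (deriv σ x)]

/-- The operator `pmlD2` is `pmlD1` with the two coordinates exchanged. -/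
lemma pmlD2_eq_pmlD1_swap (σ : ℝ → ℝ) (g : ℝ → ℝ → ℂ) :
    pmlD2 σ g = fun x y => pmlD1 σ (fun x y => g y x) y x := rfl

/-- A function that is an exponential of the stretched second coordinate on each line is an
eigenfunction of `pmlD2`. -/
lemma pmlD2_eq_const_mul {σ : ℝ → ℝ} (hσ : Differentiable ℝ σ) {g : ℝ → ℝ → ℂ} {a c : ℂ}
    {b : ℝ → ℂ}
    (hg : ∀ x y : ℝ, g x y = a * Complex.exp (c * ((y : ℂ) + Complex.I * (σ y : ℂ)) + b x)) :
    pmlD2 σ g = fun x y => c * g x y := by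
  rw [pmlD2_eq_pmlD1_swap, pmlD1_eq_const_mul hσ fun x y => hg y x]

/-- The modified plane wave `F^σ(x) = exp(i ω (r₁ x₁^σ + r₂ x₂^σ))`, with complex-stretched
coordinates `x_d^σ = x_d + i σ(x_d)`, satisfies the PML-modified Helmholtz equation
`−D₁(D₁ F^σ) − D₂(D₂ F^σ) − ω² F^σ = 0` wherever `1 + i σ′(x_d) ≠ 0`. -/
theorem modified_plane_wave_satisfies_pml_helmholtz_2d (ω : ℝ) (σ : ℝ → ℝ)
    (hσ : Differentiable ℝ σ) (r₁ r₂ : ℝ) (hr : r₁ ^ 2 + r₂ ^ 2 = 1)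
    (Fσ : ℝ → ℝ → ℂ)
    (hF : ∀ x₁ x₂ : ℝ, Fσ x₁ x₂ = Complex.exp (Complex.I * ω *
      ((r₁ : ℂ) * ((x₁ : ℂ) + Complex.I * (σ x₁ : ℂ)) +
       (r₂ : ℂ) * ((x₂ : ℂ) + Complex.I * (σ x₂ : ℂ)))))
    (x₁ x₂ : ℝ)
    (h1 : (1 : ℂ) + Complex.I * ((deriv σ x₁ : ℝ) : ℂ) ≠ 0)
    (h2 : (1 : ℂ) + Complex.I * ((deriv σ x₂ : ℝ) : ℂ) ≠ 0) :
    -(pmlD1 σ (pmlD1 σ Fσ)) x₁ x₂ - (pmlD2 σ (pmlD2 σ Fσ)) x₁ x₂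
      - (ω : ℂ) ^ 2 * Fσ x₁ x₂ = 0 := by
  have hD1 (a : ℂ) : pmlD1 σ (fun x y => a * Fσ x y) =
      fun x y => Complex.I * ω * r₁ * (a * Fσ x y) :=
    pmlD1_eq_const_mul hσ (a := a)
      (b := fun y => Complex.I * ω * (r₂ * ((y : ℂ) + Complex.I * (σ y : ℂ)))) fun x y => by
        rw [hF]; ring_nf
  have hD2 (a : ℂ) : pmlD2 σ (fun x y => a * Fσ x y) =
      fun x y => Complex.I * ω * r₂ * (a * Fσ x y) :=
    pmlD2_eq_const_mul hσ (a := a)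
      (b := fun x => Complex.I * ω * (r₁ * ((x : ℂ) + Complex.I * (σ x : ℂ)))) fun x y => by
        rw [hF]; ring_nf
  have hF1 : pmlD1 σ Fσ = fun x y => Complex.I * ω * r₁ * Fσ x y := by simpa using hD1 1
  have hF2 : pmlD2 σ Fσ = fun x y => Complex.I * ω * r₂ * Fσ x y := by simpa using hD2 1
  have hr' : (r₁ : ℂ) ^ 2 + (r₂ : ℂ) ^ 2 = 1 := by exact_mod_cast hr
  rw [hF1, hF2, hD1, hD2]
  linear_combination (-(ω : ℂ) ^ 2 * Fσ x₁ x₂ * (r₁ ^ 2 + r₂ ^ 2)) * Complex.I_sq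
    + (ω : ℂ) ^ 2 * Fσ x₁ x₂ * hr'
end

section
/- Let ℓ ≥ 1 and n ≥ 1, and let H be a complex block tridiagonal matrix with ℓ×ℓ blocks of size n×n, i.e. H is a matrix indexed by (Fin ℓ × Fin n) whose (i,j) block H_{[i,j]} is zero whenever |i − j| > 1. Define the Schur complements recursively by S_{[1]} = H_{[1,1]} and S_{[i]} = H_{[i,i]} − H_{[i,i−1]} S_{[i−1]}^{-1} H_{[i−1,i]} for i = 2, …, ℓ, and suppose each S_{[i]} is invertible. Then for every i, the leading principal block matrix H_{[1:i,1:i]} (the block tridiagonal matrix formed by blocks with both indices at most i) is invertible, and the bottom-right n×n block of its inverse equals S_{[i]}^{-1}. -/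
open Matrix

/-- The `(i,j)` block of size `n × n` of a matrix indexed by `Fin ℓ × Fin n`. -/
def Hblock {ℓ n : ℕ} (H : Matrix (Fin ℓ × Fin n) (Fin ℓ × Fin n) ℂ) (i j : Fin ℓ) :
    Matrix (Fin n) (Fin n) ℂ :=
  Matrix.of fun a b => H (i, a) (j, b)

/-- The leading principal block submatrix `H_{[1:i,1:i]}`, formed by the blocks of `H`
with both block indices at most `i`. -/
def Hlead {ℓ n : ℕ} (H : Matrix (Fin ℓ × Fin n) (Fin ℓ × Fin n) ℂ) (i : Fin ℓ) :
    Matrix ({j : Fin ℓ // j ≤ i} × Fin n) ({j : Fin ℓ // j ≤ i} × Fin n) ℂ :=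
  Matrix.of fun p q => H (p.1.1, p.2) (q.1.1, q.2)

/-- If the upper left block `A` and its Schur complement are invertible, then so is the whole
block matrix, and the lower right block of the inverse is the inverse of the Schur complement. -/
theorem isUnit_fromBlocks_and_inv_toBlocks₂₂ {m k R : Type*} [Fintype m] [Fintype k]
    [DecidableEq m] [DecidableEq k] [CommRing R] {A : Matrix m m R} {B : Matrix m k R}
    {C : Matrix k m R} {D : Matrix k k R} (hA : IsUnit A) (hS : IsUnit (D - C * A⁻¹ * B)) :
    IsUnit (fromBlocks A B C D) ∧
      (fromBlocks A B C D)⁻¹.toBlocks₂₂ = (D - C * A⁻¹ * B)⁻¹ := by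
  let := hA.invertible
  rw [← invOf_eq_nonsing_inv A] at hS ⊢
  have hM : IsUnit (fromBlocks A B C D) := isUnit_fromBlocks_iff_of_invertible₁₁.2 hS
  let := hS.invertible
  let := hM.invertible
  refine ⟨hM, ?_⟩
  rw [← invOf_eq_nonsing_inv, invOf_fromBlocks₁₁_eq, toBlocks_fromBlocks₂₂,
    invOf_eq_nonsing_inv]

/-- The indices of the first block slice are the indices within a single block. -/
def firstSliceEquiv {ℓ n : ℕ} (hℓ : 0 < ℓ) :
    Fin n ≃ {j : Fin ℓ // j ≤ ⟨0, hℓ⟩} × Fin n where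
  toFun a := (⟨⟨0, hℓ⟩, le_rfl⟩, a)
  invFun p := p.2
  left_inv _ := rfl
  right_inv := by
    rintro ⟨⟨⟨j, hj⟩, hj'⟩, a⟩
    obtain rfl : j = 0 := Nat.le_zero.1 hj'
    rfl

/-- The indices of the block slices up to `i + 1` split into those of the slices up to `i` and
those of slice `i + 1`. -/
def leadSumEquiv {ℓ n : ℕ} (i : ℕ) (h : i + 1 < ℓ) :
    ({j : Fin ℓ // j ≤ ⟨i, Nat.lt_of_succ_lt h⟩} × Fin n) ⊕ Fin n ≃
      {j : Fin ℓ // j ≤ ⟨i + 1, h⟩} × Fin n where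
  toFun := Sum.elim
    (fun p => (⟨p.1.1, p.1.2.trans (Fin.mk_le_mk.2 i.le_succ)⟩, p.2))
    (fun a => (⟨⟨i + 1, h⟩, le_rfl⟩, a))
  invFun p :=
    if hp : p.1.1 ≤ ⟨i, Nat.lt_of_succ_lt h⟩ then Sum.inl (⟨p.1.1, hp⟩, p.2) else Sum.inr p.2
  left_inv := by
    rintro (⟨⟨j, hj⟩, a⟩ | a)
    · simp [hj]
    · simp
  right_inv := by
    rintro ⟨⟨⟨j, hj⟩, hj'⟩, a⟩
    by_cases hji : j ≤ i
    · simp [hji]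
    · obtain rfl : j = i + 1 := le_antisymm hj' (Nat.lt_of_not_le hji)
      simp

/-- A product `C * A * B` in which the nonzero columns of `C` and rows of `B` lie in a single
slice `i₀` only involves the `(i₀, i₀)` block of `A`. -/
theorem mul_mul_eq_of_slice_support {ι m k R : Type*} [Fintype ι] [Fintype m]
    [NonUnitalSemiring R] (i₀ : ι) (A : Matrix (ι × m) (ι × m) R) (B : Matrix (ι × m) k R)
    (C : Matrix k (ι × m) R) (hB : ∀ i, i ≠ i₀ → ∀ a b, B (i, a) b = 0)
    (hC : ∀ i, i ≠ i₀ → ∀ a b, C a (i, b) = 0) :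
    C * A * B = C.submatrix id (Prod.mk i₀) * A.submatrix (Prod.mk i₀) (Prod.mk i₀) *
      B.submatrix (Prod.mk i₀) id := by
  ext a b
  simp only [mul_apply, Fintype.sum_prod_type, submatrix_apply, id]
  rw [Finset.sum_eq_single_of_mem i₀ (Finset.mem_univ _)
    fun i _ hi => by simp [hB i hi]]
  refine Finset.sum_congr rfl fun c _ => ?_
  rw [Finset.sum_eq_single_of_mem i₀ (Finset.mem_univ _)
    fun i _ hi => by simp [hC i hi]]

/-- For a block tridiagonal matrix `H` whose Schur complements
`S_{[1]} = H_{[1,1]}`, `S_{[i]} = H_{[i,i]} − H_{[i,i−1]} S_{[i−1]}⁻¹ H_{[i−1,i]}`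
are all invertible, every leading principal block matrix `H_{[1:i,1:i]}` is invertible
and the bottom-right `n × n` block of its inverse equals `S_{[i]}⁻¹`. -/
theorem schur_complement_inverse_block (ℓ n : ℕ) (hℓ : 0 < ℓ) (hn : 0 < n)
    (H : Matrix (Fin ℓ × Fin n) (Fin ℓ × Fin n) ℂ)
    (htri : ∀ i j : Fin ℓ, ((i : ℕ) + 1 < (j : ℕ) ∨ (j : ℕ) + 1 < (i : ℕ)) →
      Hblock H i j = 0)
    (S : Fin ℓ → Matrix (Fin n) (Fin n) ℂ)
    (hS0 : S ⟨0, hℓ⟩ = Hblock H ⟨0, hℓ⟩ ⟨0, hℓ⟩)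
    (hSrec : ∀ (i : ℕ) (h : i + 1 < ℓ),
      S ⟨i + 1, h⟩ = Hblock H ⟨i + 1, h⟩ ⟨i + 1, h⟩ -
        Hblock H ⟨i + 1, h⟩ ⟨i, by omega⟩ * (S ⟨i, by omega⟩)⁻¹ *
          Hblock H ⟨i, by omega⟩ ⟨i + 1, h⟩)
    (hSinv : ∀ i : Fin ℓ, IsUnit (S i)) :
    ∀ i : Fin ℓ, IsUnit (Hlead H i) ∧
      ∀ a b : Fin n,
        (Hlead H i)⁻¹ (⟨i, le_refl i⟩, a) (⟨i, le_refl i⟩, b) = (S i)⁻¹ a b := by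
  rintro ⟨i, hi⟩
  induction i with
  | zero =>
    have hM : (Hlead H ⟨0, hℓ⟩).submatrix (firstSliceEquiv hℓ) (firstSliceEquiv hℓ) =
        S ⟨0, hℓ⟩ := hS0.symm
    refine ⟨(isUnit_submatrix_equiv (firstSliceEquiv hℓ) (firstSliceEquiv hℓ)).1
      (hM ▸ hSinv _), fun a b => ?_⟩
    rw [← hM, inv_submatrix_equiv]
    rfl
  | succ i ih =>
    obtain ⟨hA, hAinv⟩ := ih (Nat.lt_of_succ_lt hi)
    set e := leadSumEquiv (n := n) i hi
    set M := (Hlead H ⟨i + 1, hi⟩).submatrix e e with hM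
    have hM₁₁ : M.toBlocks₁₁ = Hlead H ⟨i, Nat.lt_of_succ_lt hi⟩ := rfl
    have hne : ∀ j : {j : Fin ℓ // j ≤ ⟨i, Nat.lt_of_succ_lt hi⟩},
        j ≠ ⟨⟨i, Nat.lt_of_succ_lt hi⟩, le_rfl⟩ → (j.1 : ℕ) + 1 < i + 1 := fun j hj =>
      Nat.succ_lt_succ (lt_of_le_of_ne j.2 fun h => hj (Subtype.ext (Fin.ext h)))
    have hSchur : M.toBlocks₂₂ - M.toBlocks₂₁ * M.toBlocks₁₁⁻¹ * M.toBlocks₁₂ =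
        S ⟨i + 1, hi⟩ := by
      rw [mul_mul_eq_of_slice_support ⟨⟨i, Nat.lt_of_succ_lt hi⟩, le_rfl⟩ _ _ _
        (fun j hj a b => congr_fun₂ (htri j.1 ⟨i + 1, hi⟩ (Or.inl (hne j hj))) a b)
        (fun j hj a b => congr_fun₂ (htri ⟨i + 1, hi⟩ j.1 (Or.inr (hne j hj))) a b), hM₁₁,
        show (Hlead H ⟨i, Nat.lt_of_succ_lt hi⟩)⁻¹.submatrix _ _ = _ from Matrix.ext hAinv,
        hSrec i hi]
      rfl
    obtain ⟨hU, hinv⟩ := isUnit_fromBlocks_and_inv_toBlocks₂₂ (hM₁₁ ▸ hA)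
      (hSchur ▸ hSinv ⟨i + 1, hi⟩)
    rw [fromBlocks_toBlocks] at hU hinv
    rw [hSchur, hM, inv_submatrix_equiv] at hinv
    exact ⟨(isUnit_submatrix_equiv e e).1 hU, fun a b => congr_fun₂ hinv a b⟩
end

section
/- Let ℓ ≥ 1 and n ≥ 1, let H be a complex block tridiagonal matrix with ℓ×ℓ blocks of size n×n whose Schur complements S_{[1]} = H_{[1,1]}, S_{[i]} = H_{[i,i]} − H_{[i,i−1]} S_{[i−1]}^{-1} H_{[i−1,i]} are all invertible. Fix i ∈ {1, …, ℓ} and a vector v ∈ ℂⁿ. If the block vector (w_{[1]}, …, w_{[i]}) solves the leading principal block system H_{[1:i,1:i]} (w_{[1]}, …, w_{[i]}) = (0, …, 0, v), whose right-hand side is zero in the first i−1 blocks and equals v in the last block, then the last block of the solution satisfies w_{[i]} = S_{[i]}^{-1} v. -/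
open Matrix

/-- Splitting a sum over `Fin ℓ` at a point `k`. -/
lemma sum_eq_sum_Iio_add_add_sum_Ioi {ℓ : ℕ} {M : Type*} [AddCommMonoid M] (f : Fin ℓ → M)
    (k : Fin ℓ) :
    ∑ m, f m = ∑ m ∈ Finset.Iio k, f m + f k + ∑ m ∈ Finset.Ioi k, f m := by
  have hle : Finset.univ.filter (fun m => m ≤ k) = insert k (Finset.Iio k) := by
    ext m
    simp [le_iff_eq_or_lt]
  have hlt : Finset.univ.filter (fun m => ¬ m ≤ k) = Finset.Ioi k := by
    ext m
    simp
  rw [← Finset.sum_filter_add_sum_filter_not Finset.univ (fun m => m ≤ k), hle, hlt,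
    Finset.sum_insert (by simp), add_comm (f k)]

/-- Block forward elimination: if the first `k + 1` block rows of the system `H x = r` hold and
`r` vanishes in the first `k` blocks, then eliminating the blocks before `k` replaces the diagonal
block by the Schur complement. -/
lemma schur_mulVec_add_sum_Ioi {ℓ n : ℕ} (hℓ : 0 < ℓ)
    (H : Matrix (Fin ℓ × Fin n) (Fin ℓ × Fin n) ℂ)
    (htri : ∀ i j : Fin ℓ, ((i : ℕ) + 1 < (j : ℕ) ∨ (j : ℕ) + 1 < (i : ℕ)) →
      Hblock H i j = 0)
    (S : Fin ℓ → Matrix (Fin n) (Fin n) ℂ)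
    (hS0 : S ⟨0, hℓ⟩ = Hblock H ⟨0, hℓ⟩ ⟨0, hℓ⟩)
    (hSrec : ∀ (i : ℕ) (h : i + 1 < ℓ),
      S ⟨i + 1, h⟩ = Hblock H ⟨i + 1, h⟩ ⟨i + 1, h⟩ -
        Hblock H ⟨i + 1, h⟩ ⟨i, by omega⟩ * (S ⟨i, by omega⟩)⁻¹ *
          Hblock H ⟨i, by omega⟩ ⟨i + 1, h⟩)
    (hSinv : ∀ i : Fin ℓ, IsUnit (S i))
    (x r : Fin ℓ → Fin n → ℂ) (k : ℕ) (hk : k < ℓ)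
    (hrow : ∀ j : Fin ℓ, (j : ℕ) ≤ k → ∑ m, Hblock H j m *ᵥ x m = r j)
    (hr : ∀ j : Fin ℓ, (j : ℕ) < k → r j = 0) :
    S ⟨k, hk⟩ *ᵥ x ⟨k, hk⟩ + ∑ m ∈ Finset.Ioi ⟨k, hk⟩, Hblock H ⟨k, hk⟩ m *ᵥ x m =
      r ⟨k, hk⟩ := by
  induction k with
  | zero =>
    have hempty : Finset.Iio (⟨0, hk⟩ : Fin ℓ) = ∅ := by
      ext m
      simp [Fin.lt_def]
    rw [← hrow _ le_rfl, sum_eq_sum_Iio_add_add_sum_Ioi _ ⟨0, hk⟩, hempty, hS0]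
    simp
  | succ k ih =>
    have hk' : k < ℓ := by omega
    have hprev := ih hk' (fun j hj => hrow j (by omega)) (fun j hj => hr j (by omega))
    rw [hr ⟨k, hk'⟩ (Nat.lt_succ_self k),
      Finset.sum_eq_single_of_mem ⟨k + 1, hk⟩ (by simp [Fin.lt_def])] at hprev
    swap
    · intro m hm hne
      have hm' : k < (m : ℕ) := by simpa [Fin.lt_def] using hm
      have hne' : (m : ℕ) ≠ k + 1 := fun h => hne (Fin.ext h)
      rw [htri _ m (Or.inl (show k + 1 < (m : ℕ) by omega)), zero_mulVec]
    have hxk : x ⟨k, hk'⟩ =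
        -((S ⟨k, hk'⟩)⁻¹ *ᵥ (Hblock H ⟨k, hk'⟩ ⟨k + 1, hk⟩ *ᵥ x ⟨k + 1, hk⟩)) := by
      have hdet := (isUnit_iff_isUnit_det _).1 (hSinv ⟨k, hk'⟩)
      rw [← mulVec_neg, ← eq_neg_of_add_eq_zero_left hprev, mulVec_mulVec,
        nonsing_inv_mul _ hdet, one_mulVec]
    have hrow' := hrow ⟨k + 1, hk⟩ le_rfl
    rw [sum_eq_sum_Iio_add_add_sum_Ioi _ ⟨k + 1, hk⟩,
      Finset.sum_eq_single_of_mem ⟨k, hk'⟩ (by simp [Fin.lt_def])] at hrow'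
    swap
    · intro m hm hne
      have hm' : (m : ℕ) < k + 1 := by simpa [Fin.lt_def] using hm
      have hne' : (m : ℕ) ≠ k := fun h => hne (Fin.ext h)
      rw [htri _ m (Or.inr (show (m : ℕ) + 1 < k + 1 by omega)), zero_mulVec]
    rw [← hrow', hSrec k hk, hxk, sub_mulVec, mulVec_neg, mulVec_mulVec, mulVec_mulVec,
      Matrix.mul_assoc]
    abel

/-- For a block tridiagonal matrix `H` with invertible Schur complements `S_{[i]}`:
if `(w_{[1]}, …, w_{[i]})` solves the leading principal block system with right-hand side
zero in the first `i − 1` blocks and `v` in the last block, then `w_{[i]} = S_{[i]}⁻¹ v`. -/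
theorem last_block_of_leading_system (ℓ n : ℕ) (hℓ : 0 < ℓ) (hn : 0 < n)
    (H : Matrix (Fin ℓ × Fin n) (Fin ℓ × Fin n) ℂ)
    (htri : ∀ i j : Fin ℓ, ((i : ℕ) + 1 < (j : ℕ) ∨ (j : ℕ) + 1 < (i : ℕ)) →
      Hblock H i j = 0)
    (S : Fin ℓ → Matrix (Fin n) (Fin n) ℂ)
    (hS0 : S ⟨0, hℓ⟩ = Hblock H ⟨0, hℓ⟩ ⟨0, hℓ⟩)
    (hSrec : ∀ (i : ℕ) (h : i + 1 < ℓ),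
      S ⟨i + 1, h⟩ = Hblock H ⟨i + 1, h⟩ ⟨i + 1, h⟩ -
        Hblock H ⟨i + 1, h⟩ ⟨i, by omega⟩ * (S ⟨i, by omega⟩)⁻¹ *
          Hblock H ⟨i, by omega⟩ ⟨i + 1, h⟩)
    (hSinv : ∀ i : Fin ℓ, IsUnit (S i))
    (i : Fin ℓ) (v : Fin n → ℂ)
    (w : {j : Fin ℓ // j ≤ i} × Fin n → ℂ)
    (hw : (Hlead H i).mulVec w = fun p => if p.1.1 = i then v p.2 else 0) :
    (fun a => w (⟨i, le_refl i⟩, a)) = (S i)⁻¹.mulVec v := by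
  let x : Fin ℓ → Fin n → ℂ := fun j a => if h : j ≤ i then w (⟨j, h⟩, a) else 0
  let r : Fin ℓ → Fin n → ℂ := fun j => if j = i then v else 0
  have hrow : ∀ j : Fin ℓ, (j : ℕ) ≤ i → ∑ m, Hblock H j m *ᵥ x m = r j := by
    intro j hj
    ext a
    have hja := congrFun hw (⟨j, hj⟩, a)
    have hra : r j a = if j = i then v a else 0 := by
      by_cases h : j = i <;> simp [r, h]
    rw [hra, ← hja, Finset.sum_apply, mulVec, dotProduct, Fintype.sum_prod_type,
      ← Fintype.sum_subtype_add_sum_subtype (fun m => m ≤ i) (fun m => (Hblock H j m *ᵥ x m) a)]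
    have hright : ∑ m : {m : Fin ℓ // ¬ m ≤ i}, (Hblock H j m *ᵥ x m) a = 0 := by
      refine Finset.sum_eq_zero fun m _ => ?_
      have hx : x m = 0 := by
        ext b
        exact dif_neg m.2
      rw [hx, mulVec_zero, Pi.zero_apply]
    rw [hright, add_zero]
    refine Finset.sum_congr rfl fun m _ => ?_
    rw [mulVec, dotProduct]
    refine Finset.sum_congr rfl fun b _ => ?_
    have hxm : x m b = w (m, b) := dif_pos m.2
    rw [hxm]
    rfl
  have hfinal := schur_mulVec_add_sum_Ioi hℓ H htri S hS0 hSrec hSinv x r i i.isLt hrow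
    (fun j hj => if_neg (Fin.ne_of_lt hj))
  rw [Finset.sum_eq_zero] at hfinal
  swap
  · intro m hm
    have hx : x m = 0 := by
      ext a
      exact dif_neg (not_le.2 (Finset.mem_Ioi.1 hm))
    rw [hx, mulVec_zero]
  have hxi : x i = fun a => w (⟨i, le_refl i⟩, a) := by
    ext a
    exact dif_pos le_rfl
  have hri : r i = v := if_pos rfl
  rw [add_zero, Fin.eta, hxi, hri] at hfinal
  rw [← hfinal, mulVec_mulVec, nonsing_inv_mul _ ((isUnit_iff_isUnit_det _).1 (hSinv i)),
    one_mulVec]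
end
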